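/- arXiv:1506.04159 — 2 statements merged into one kernel-verified Lean document; each statement's English description precedes it below -/
import Mathlib

section
/- Let ρ : ℝ³ → ℝ be continuous with compact support contained in the open ball B_R of radius R centered at the origin, let Φ solve ΔΦ = −4πρ with Φ(x) → 0 as |x| → ∞, set Q = ∫ ρ, and E = (1/(8π)) ∫_{ℝ³} |∇Φ|² dx. Then Q² ≤ 2 E R. -/
open MeasureTheory Real Gradient Filter

noncomputable abbrev E3 := EuclideanSpace ℝ (Fin 3)

noncomputable def e3 (i : Fin 3) : E3 := EuclideanSpace.single i 1

/-- The Laplacian on ℝ³ as the trace of the second derivative. -/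
noncomputable def lap3 (f : E3 → ℝ) (x : E3) : ℝ :=
  ∑ i, iteratedFDeriv ℝ 2 f x ![e3 i, e3 i]

/-- A continuous cutoff of `s ↦ s⁻²` vanishing for `s ≤ a` and for `s ≥ B`, whose integral
is still at least `R⁻¹`. -/
lemma exists_cutoff_inv_sq {a R : ℝ} (ha : 0 < a) (haR : a < R) :
    ∃ (f : ℝ → ℝ) (B : ℝ), Continuous f ∧ a < B ∧ (∀ s ≤ a, f s = 0) ∧
      (∀ s, B ≤ s → f s = 0) ∧ (∀ s, s ^ 2 * f s ^ 2 ≤ f s) ∧ 1 / R ≤ ∫ s in (0 : ℝ)..B, f s := by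
  obtain ⟨m, ham, hmR⟩ := exists_between haR
  have hm : 0 < m := ha.trans ham
  have hR : 0 < R := hm.trans hmR
  have hpos : 0 < 1 / m - 1 / R := sub_pos.2 (one_div_lt_one_div_of_lt hm hmR)
  set b := 1 / (1 / m - 1 / R) with hb
  have hbm : m < b := by
    rw [hb, lt_div_iff₀ hpos]
    have : m * (1 / m - 1 / R) = 1 - m / R := by field_simp
    have : 0 < m / R := by positivity
    linarith
  let w : ContDiffBump ((m + b) / 2) :=
    ⟨(b - m) / 2, (b - m) / 2 + (m - a), by linarith, by linarith⟩
  have hw0 : ∀ s, (s ≤ a ∨ b + (m - a) ≤ s) → w s = 0 := by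
    intro s hs
    refine w.zero_of_le_dist ?_
    rw [Real.dist_eq]
    show (b - m) / 2 + (m - a) ≤ _
    rcases hs with hs | hs
    · rw [abs_sub_comm]; exact le_trans (by linarith) (le_abs_self _)
    · exact le_trans (by linarith) (le_abs_self _)
  have hw1 : ∀ s ∈ Set.Icc m b, w s = 1 := by
    intro s hs
    refine w.one_of_mem_closedBall ?_
    rw [Metric.mem_closedBall, Real.dist_eq, abs_le]
    show -((b - m) / 2) ≤ _ ∧ _ ≤ (b - m) / 2
    constructor <;> linarith [hs.1, hs.2]
  have hmax : ∀ s, 0 < max a s := fun s => lt_max_of_lt_left ha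
  have hcont : Continuous fun s => w s / max a s ^ 2 :=
    w.continuous.div (by fun_prop) fun s => (pow_pos (hmax s) 2).ne'
  have hnn : ∀ s, 0 ≤ w s / max a s ^ 2 := fun s => div_nonneg w.nonneg (by positivity)
  refine ⟨fun s => w s / max a s ^ 2, b + (m - a), hcont, by linarith, ?_, ?_, ?_, ?_⟩
  · intro s hs; simp [hw0 s (.inl hs)]
  · intro s hs; simp [hw0 s (.inr hs)]
  · intro s
    rcases le_total s a with hs | hs
    · simp [hw0 s (.inl hs)]
    · have hs0 : 0 < s := ha.trans_le hs
      simp only [max_eq_right hs]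
      have h1 : w s ≤ 1 := w.le_one
      have h0 : 0 ≤ w s := w.nonneg
      rw [div_pow, ← mul_div_assoc, div_le_div_iff₀ (by positivity) (by positivity)]
      have : w s ^ 2 ≤ w s := by nlinarith
      have h4 : 0 ≤ s ^ 4 := by positivity
      nlinarith [mul_le_mul_of_nonneg_right this h4]
  · have hle : ∫ s in m..b, w s / max a s ^ 2 ≤
        ∫ s in (0 : ℝ)..(b + (m - a)), w s / max a s ^ 2 :=
      intervalIntegral.integral_mono_interval hm.le hbm.le (by linarith)
        (Eventually.of_forall hnn) (hcont.intervalIntegrable _ _)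
    refine le_trans (le_of_eq ?_) hle
    have hderiv : ∀ s ∈ Set.uIcc m b, HasDerivAt (fun s : ℝ => -s⁻¹) (w s / max a s ^ 2) s := by
      intro s hs
      rw [Set.uIcc_of_le hbm.le] at hs
      have hs0 : s ≠ 0 := (hm.trans_le hs.1).ne'
      rw [hw1 s hs, max_eq_right (ham.le.trans hs.1)]
      convert! (hasDerivAt_inv hs0).neg using 1
      simp
    rw [intervalIntegral.integral_eq_sub_of_hasDerivAt hderiv (hcont.intervalIntegrable _ _), hb]
    simp

/-- The integral over `[r, B]` does not depend on `r` in an interval where `f` vanishes. -/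
lemma integral_eq_of_vanishing {f : ℝ → ℝ} {a r : ℝ} (B : ℝ) (hf : Continuous f)
    (hfa : ∀ s ≤ a, f s = 0) (hr0 : 0 ≤ r) (hra : r ≤ a) :
    ∫ s in r..B, f s = ∫ s in (0 : ℝ)..B, f s := by
  have h : ∫ s in (0 : ℝ)..r, f s = 0 := by
    rw [intervalIntegral.integral_congr (g := fun _ => 0)]
    · simp
    · intro s hs
      rw [Set.uIcc_of_le hr0] at hs
      exact hfa s (hs.2.trans hra)
  rw [← intervalIntegral.integral_add_adjacent_intervals (hf.intervalIntegrable 0 r)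
    (hf.intervalIntegrable r B), h, zero_add]

/-- A radial function `x ↦ ∫_{‖x‖}^B f` with `f` vanishing near the origin is differentiable. -/
lemma hasFDerivAt_radial_primitive {F : Type*} [NormedAddCommGroup F] [InnerProductSpace ℝ F]
    {f : ℝ → ℝ} {a : ℝ} (B : ℝ) (hf : Continuous f) (ha : 0 < a) (hfa : ∀ s ≤ a, f s = 0)
    (x : F) :
    HasFDerivAt (fun y : F => ∫ s in ‖y‖..B, f s)
      (-(f ‖x‖ / max a ‖x‖) • innerSL ℝ x) x := by
  have hh : HasDerivAt (fun r : ℝ => ∫ s in r..B, f s) (-f ‖x‖) ‖x‖ :=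
    intervalIntegral.integral_hasDerivAt_left (hf.intervalIntegrable _ _)
      (hf.stronglyMeasurableAtFilter _ _) hf.continuousAt
  rcases lt_or_ge ‖x‖ a with hx | hx
  · rw [hfa _ hx.le, zero_div, neg_zero, zero_smul]
    refine (hasFDerivAt_const (∫ s in (0 : ℝ)..B, f s) x).congr_of_eventuallyEq ?_
    filter_upwards [continuous_norm.continuousAt.eventually_lt continuousAt_const hx] with y hy
    exact integral_eq_of_vanishing B hf hfa (norm_nonneg y) hy.le
  · have hx0 : 0 < ‖x‖ := ha.trans_le hx
    have hn : HasFDerivAt (fun y : F => ‖y‖) ((1 / ‖x‖) • innerSL ℝ x) x := by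
      have h := (hasStrictFDerivAt_norm_sq x).hasFDerivAt.sqrt (by positivity)
      simp only [Real.sqrt_sq (norm_nonneg _)] at h
      convert! h using 1
      ext y
      simp
      field_simp
    convert! hh.comp_hasFDerivAt x hn using 1
    rw [max_eq_right hx, smul_smul]
    congr 1
    ring

/-- Green's first identity in `ℝ³` against a compactly supported `C¹` test function. -/
lemma integral_fderiv_apply_gradient_eq {Φ u : E3 → ℝ} {v : E3 → E3} (hΦ : ContDiff ℝ 2 Φ)
    (hu : ∀ x, HasFDerivAt u (innerSL ℝ (v x)) x) (hv : Continuous v)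
    (hus : HasCompactSupport u) :
    ∫ x, fderiv ℝ Φ x (v x) = -∫ x, lap3 Φ x * u x := by
  have hΦ1 : ContDiff ℝ 1 (fderiv ℝ Φ) := hΦ.fderiv_right (by norm_num)
  have huc : Continuous u := continuous_iff_continuousAt.2 fun x => (hu x).continuousAt
  have hfu : ∀ x i, fderiv ℝ u x (e3 i) = v x i := by
    intro x i
    rw [(hu x).fderiv]
    simp [e3, EuclideanSpace.inner_single_right]
  have hvs : ∀ i, HasCompactSupport fun x => v x i := by
    intro i
    have := hus.fderiv_apply (𝕜 := ℝ) (e3 i)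
    simpa only [hfu] using this
  let p : Fin 3 → E3 → ℝ := fun i x => fderiv ℝ Φ x (e3 i)
  have hp : ∀ i, ContDiff ℝ 1 (p i) := fun i => hΦ1.clm_apply contDiff_const
  have hpc : ∀ i, Continuous (p i) := fun i => (hp i).continuous
  have hpc' : ∀ i, Continuous fun x => fderiv ℝ (p i) x (e3 i) := fun i =>
    ((hp i).continuous_fderiv one_ne_zero).clm_apply continuous_const
  have hvi : ∀ i, Continuous fun x => v x i := fun i => by fun_prop
  have I1 : ∀ i, Integrable fun x => fderiv ℝ (p i) x (e3 i) * u x := fun i =>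
    ((hpc' i).mul huc).integrable_of_hasCompactSupport hus.mul_left
  have I2 : ∀ i, Integrable fun x => p i x * v x i := fun i =>
    ((hpc i).mul (hvi i)).integrable_of_hasCompactSupport (hvs i).mul_left
  have I3 : ∀ i, Integrable fun x => p i x * u x := fun i =>
    ((hpc i).mul huc).integrable_of_hasCompactSupport hus.mul_left
  have parts : ∀ i, ∫ x, p i x * v x i = -∫ x, fderiv ℝ (p i) x (e3 i) * u x := by
    intro i
    have := integral_mul_fderiv_eq_neg_fderiv_mul_of_integrable (μ := volume) (f := p i) (g := u)
      (v := e3 i) (I1 i) (by simpa only [hfu] using I2 i) (I3 i)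
      (fun x _ => (hp i).differentiable one_ne_zero x) (fun x _ => (hu x).differentiableAt)
    simpa only [hfu] using this
  have hL : ∀ x, fderiv ℝ Φ x (v x) = ∑ i, p i x * v x i := by
    intro x
    have hvx : v x = ∑ i, v x i • e3 i := by
      ext j
      simp [e3, Pi.single_apply]
    conv_lhs => rw [hvx]
    simp only [map_sum, map_smul, smul_eq_mul, p, mul_comm]
  have hlap : ∀ x, lap3 Φ x * u x = ∑ i, fderiv ℝ (p i) x (e3 i) * u x := by
    intro x
    rw [lap3, Finset.sum_mul]
    refine Finset.sum_congr rfl fun i _ => ?_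
    rw [iteratedFDeriv_two_apply]
    have := ((hΦ1.differentiable one_ne_zero x).hasFDerivAt.clm_apply
      (hasFDerivAt_const (e3 i) x)).fderiv
    simp only [p]
    rw [this]
    simp
  simp only [hL, hlap]
  rw [integral_finsetSum _ fun i _ => I2 i, integral_finsetSum _ fun i _ => I1 i,
    ← Finset.sum_neg_distrib]
  exact Finset.sum_congr rfl fun i _ => parts i

/-- Electrostatic Bekenstein-type inequality: if `ρ` is continuous, compactly supported in the
ball `B_R`, `ΔΦ = −4πρ` with `Φ → 0` at infinity, `Q = ∫ρ`, and
`E = (1/(8π)) ∫ |∇Φ|²`, then `Q² ≤ 2 E R`. -/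
theorem electrostatic_bekenstein (R : ℝ) (hR : 0 < R) (ρ : E3 → ℝ) (Φ : E3 → ℝ)
    (hρc : Continuous ρ) (hρsupp : HasCompactSupport ρ)
    (hsupp : tsupport ρ ⊆ Metric.ball (0 : E3) R)
    (hΦ : ContDiff ℝ 2 Φ)
    (hpoisson : ∀ x, lap3 Φ x = -(4 * π) * ρ x)
    (hdecay : Tendsto Φ (cocompact E3) (nhds 0))
    (hint : Integrable (fun x => ‖∇ Φ x‖ ^ 2)) :
    (∫ x, ρ x) ^ 2 ≤ 2 * ((1 / (8 * π)) * ∫ x, ‖∇ Φ x‖ ^ 2) * R := by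
  obtain ⟨a, ⟨ha, haR⟩, hasupp⟩ :=
    exists_pos_lt_subset_ball hR (isClosed_tsupport ρ) hsupp
  obtain ⟨f, B, hf, haB, hfa, hfB, hfsq, hfR⟩ := exists_cutoff_inv_sq ha haR
  set c := ∫ s in (0 : ℝ)..B, f s with hc
  set Q := ∫ x, ρ x
  let u : E3 → ℝ := fun x => ∫ s in ‖x‖..B, f s
  let v : E3 → E3 := fun x => -(f ‖x‖ / max a ‖x‖) • x
  have hu : ∀ x, HasFDerivAt u (innerSL ℝ (v x)) x := by
    intro x
    convert! hasFDerivAt_radial_primitive B hf ha hfa x using 1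
    simp [v]
  have hmax : ∀ s, 0 < max a s := fun s => lt_max_of_lt_left ha
  have hv : Continuous v := by
    have hk : Continuous fun x : E3 => f ‖x‖ / max a ‖x‖ :=
      (hf.comp continuous_norm).div (by fun_prop) fun x => (hmax _).ne'
    exact hk.neg.smul continuous_id
  have hus : HasCompactSupport u := by
    refine HasCompactSupport.intro (isCompact_closedBall (0 : E3) B) fun x hx => ?_
    have hx : B ≤ ‖x‖ := by simpa using (not_le.1 (by simpa using hx)).le
    show ∫ s in ‖x‖..B, f s = 0
    rw [intervalIntegral.integral_congr (g := fun _ => 0)]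
    · simp
    · intro s hs
      rw [Set.uIcc_of_ge hx] at hs
      exact hfB s hs.1
  have hvs : HasCompactSupport v := by
    refine HasCompactSupport.intro (isCompact_closedBall (0 : E3) B) fun x hx => ?_
    have hx : B ≤ ‖x‖ := by simpa using (not_le.1 (by simpa using hx)).le
    simp [v, hfB _ hx]
  have hρu : ∀ x, ρ x * u x = ρ x * c := by
    intro x
    by_cases hx : x ∈ tsupport ρ
    · have hxa : ‖x‖ < a := by simpa using hasupp hx
      exact congrArg _ (integral_eq_of_vanishing B hf hfa (norm_nonneg x) hxa.le)
    · simp [image_eq_zero_of_notMem_tsupport hx]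
  have hflux : ∫ x, fderiv ℝ Φ x (v x) = 4 * π * c * Q := by
    rw [integral_fderiv_apply_gradient_eq hΦ hu hv hus]
    have : ∀ x, lap3 Φ x * u x = -(4 * π * c) * ρ x := fun x => by
      rw [hpoisson, mul_assoc, hρu]; ring
    simp only [this, integral_const_mul]
    ring
  have hvI : Integrable fun x => ‖v x‖ ^ 2 := by
    refine (hv.norm.pow 2).integrable_of_hasCompactSupport ?_
    exact hvs.mono fun x hx h => hx (by simp [h])
  have hΦvI : Integrable fun x => fderiv ℝ Φ x (v x) := by
    refine ((hΦ.continuous_fderiv two_ne_zero).clm_apply hv).integrable_of_hasCompactSupport ?_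
    exact hvs.mono fun x hx h => hx (by simp [h])
  have hfint : ∫ s in Set.Ioi (0 : ℝ), f s = c := by
    rw [hc, intervalIntegral.integral_of_le (ha.trans haB).le]
    refine (setIntegral_eq_of_subset_of_forall_sdiff_eq_zero measurableSet_Ioi
      Set.Ioc_subset_Ioi_self fun s hs => hfB s ?_)
    by_contra h
    exact hs.2 ⟨hs.1, (not_le.1 h).le⟩
  have hfcs : HasCompactSupport f := by
    refine HasCompactSupport.intro (isCompact_Icc (a := a) (b := B)) fun s hs => ?_
    by_cases h : s ≤ a
    · exact hfa s h
    · exact hfB s (not_lt.1 fun h' => hs ⟨(not_le.1 h).le, h'.le⟩)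
  have henergy : ∫ x, ‖v x‖ ^ 2 ≤ 4 * π * c := by
    have hvn : ∀ x, ‖v x‖ ^ 2 = (fun r => f r ^ 2) ‖x‖ := by
      intro x
      rcases le_total ‖x‖ a with hx | hx
      · simp [v, hfa _ hx]
      · have : 0 < ‖x‖ := ha.trans_le hx
        simp only [v, max_eq_right hx, norm_smul, norm_neg, Real.norm_eq_abs, mul_pow, sq_abs]
        field_simp
    have hvol : volume.real (Metric.ball (0 : E3) 1) = π * 4 / 3 := by
      rw [Measure.real, EuclideanSpace.volume_ball_fin_three]
      simp [ENNReal.toReal_ofReal (by positivity : 0 ≤ π * 4 / 3)]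
    have hmono : ∫ r in Set.Ioi (0 : ℝ), r ^ 2 * f r ^ 2 ≤ ∫ r in Set.Ioi (0 : ℝ), f r := by
      refine integral_mono_of_nonneg (Eventually.of_forall fun r => by positivity)
        (hf.integrable_of_hasCompactSupport hfcs).integrableOn (Eventually.of_forall hfsq)
    simp only [hvn]
    rw [integral_fun_norm_addHaar volume (fun r => f r ^ 2), hvol]
    simp only [finrank_euclideanSpace, Fintype.card_fin, smul_eq_mul, nsmul_eq_mul]
    rw [hfint] at hmono
    norm_num
    nlinarith [mul_le_mul_of_nonneg_left hmono pi_pos.le]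
  have hsquare : 0 ≤ ∫ x, ‖∇ Φ x - Q • v x‖ ^ 2 := integral_nonneg fun x => by positivity
  have hexpand : ∀ x, ‖∇ Φ x - Q • v x‖ ^ 2 =
      ‖∇ Φ x‖ ^ 2 - 2 * Q * fderiv ℝ Φ x (v x) + Q ^ 2 * ‖v x‖ ^ 2 := by
    intro x
    rw [norm_sub_sq_real, inner_smul_right, inner_gradient_left, norm_smul, mul_pow,
      Real.norm_eq_abs, sq_abs]
    ring
  simp only [hexpand] at hsquare
  have hsubI : Integrable fun x => ‖∇ Φ x‖ ^ 2 - 2 * Q * fderiv ℝ Φ x (v x) :=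
    hint.sub (hΦvI.const_mul _)
  rw [integral_add hsubI (hvI.const_mul _),
    integral_sub hint (hΦvI.const_mul _), integral_const_mul, integral_const_mul, hflux] at hsquare
  have hkey : 4 * π * c * Q ^ 2 ≤ ∫ x, ‖∇ Φ x‖ ^ 2 := by
    nlinarith [mul_le_mul_of_nonneg_left henergy (sq_nonneg Q)]
  have hcR : 1 ≤ c * R := by rwa [div_le_iff₀ hR] at hfR
  calc Q ^ 2 ≤ c * R * Q ^ 2 := le_mul_of_one_le_left (sq_nonneg Q) hcR
    _ = 2 * ((1 / (8 * π)) * (4 * π * c * Q ^ 2)) * R := by field_simp; ring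
    _ ≤ _ := by gcongr
end

section
/- Under the hypotheses of the electrostatic inequality (ρ supported in B_R, ΔΦ = −4πρ, decay at infinity, E = (1/8π)∫|∇Φ|², Q = ∫ρ), we have E − Q²/(2R) ≥ (1/(8π)) ∫_{B_R} |∇Φ|² dx. -/
open MeasureTheory Real Gradient Filter

/-- A `C¹` approximation of the identity function on `[0, 1]` which is locally constant outside
`(δ, 1)`. -/
lemma exists_contDiff_ramp {δ : ℝ} (hδ : 0 < δ) (hδ' : δ < 1 / 8) :
    ∃ F : ℝ → ℝ, ContDiff ℝ 1 F ∧ (∀ s ≤ δ, F s = 0) ∧ (∀ s, 1 ≤ s → F s = F 1) ∧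
      (∀ s, |deriv F s| ≤ 1) ∧ (∀ s, 1 ≤ s → deriv F s = 0) ∧ 1 - 4 * δ ≤ F 1 := by
  let g : ContDiffBump (1 / 2 : ℝ) := ⟨1 / 2 - 2 * δ, 1 / 2 - δ, by linarith, by linarith⟩
  have hg0 : ∀ s, s ≤ δ ∨ 1 ≤ s → g s = 0 := by
    intro s hs
    apply g.zero_of_le_dist
    change 1 / 2 - δ ≤ dist s (1 / 2)
    rw [Real.dist_eq]
    rcases hs with hs | hs
    · linarith [neg_le_abs (s - 1 / 2)]
    · linarith [le_abs_self (s - 1 / 2)]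
  have hint : ∀ a b, IntervalIntegrable g volume a b := fun a b =>
    g.continuous.intervalIntegrable a b
  have hderiv : ∀ s, HasDerivAt (fun s => ∫ t in (0 : ℝ)..s, g t) (g s) s := fun s =>
    intervalIntegral.integral_hasDerivAt_right (hint 0 s)
      (g.continuous.stronglyMeasurableAtFilter _ _) g.continuous.continuousAt
  have hd : deriv (fun s => ∫ t in (0 : ℝ)..s, g t) = g := funext fun s => (hderiv s).deriv
  refine ⟨fun s => ∫ t in (0 : ℝ)..s, g t, ?_, ?_, ?_, ?_, ?_, ?_⟩
  · rw [contDiff_one_iff_deriv, hd]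
    exact ⟨fun s => (hderiv s).differentiableAt, g.continuous⟩
  · intro s hs
    refine (intervalIntegral.integral_congr (g := fun _ => (0 : ℝ)) fun t ht => ?_).trans (by simp)
    apply hg0 t
    left
    exact ht.2.trans (max_le hδ.le hs)
  · intro s hs
    beta_reduce
    rw [← intervalIntegral.integral_add_adjacent_intervals (hint 0 1) (hint 1 s)]
    have : ∫ t in (1 : ℝ)..s, g t = 0 := by
      refine (intervalIntegral.integral_congr (g := fun _ => (0 : ℝ)) fun t ht => ?_).trans
        (by simp)
      apply hg0 t
      right
      exact (le_min le_rfl hs).trans ht.1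
    rw [this, add_zero]
  · intro s
    rw [hd, abs_of_nonneg g.nonneg]
    exact g.le_one
  · intro s hs
    rw [hd]
    exact hg0 s (Or.inr hs)
  · have h1 : ∫ t in (2 * δ)..(1 - 2 * δ), g t = 1 - 4 * δ := by
      have : ∫ t in (2 * δ)..(1 - 2 * δ), g t = ∫ t in (2 * δ)..(1 - 2 * δ), (1 : ℝ) := by
        refine intervalIntegral.integral_congr fun t ht => ?_
        rw [Set.uIcc_of_le (by linarith)] at ht
        apply g.one_of_mem_closedBall
        change dist t (1 / 2) ≤ 1 / 2 - 2 * δ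
        rw [Real.dist_eq, abs_le]
        constructor <;> linarith [ht.1, ht.2]
      rw [this]
      simp
      ring
    rw [← h1]
    exact intervalIntegral.integral_mono_interval (by linarith) (by linarith) (by linarith)
      (Eventually.of_forall fun t => g.nonneg) (hint 0 1)

/-- Radial cutoffs approximating the capacitary potential `min 1 (R / ‖x‖)` of a ball. -/
lemma exists_radial_cutoff {R δ : ℝ} (hR : 0 < R) (hδ : 0 < δ) (hδ' : δ < 1 / 8) :
    ∃ (χ : E3 → ℝ) (c : ℝ), ContDiff ℝ 1 χ ∧ HasCompactSupport χ ∧ 1 - 4 * δ ≤ c ∧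
      (∀ x, ‖x‖ ≤ R → χ x = c) ∧ (∀ x, ‖x‖ ≤ R → fderiv ℝ χ x = 0) ∧
      ∀ x, R < ‖x‖ → ‖fderiv ℝ χ x‖ ≤ R / ‖x‖ ^ 2 := by
  obtain ⟨F, hF, hF0, hF1, hF', hF'0, hc⟩ := exists_contDiff_ramp hδ hδ'
  let χ : E3 → ℝ := fun x => if x = 0 then F 1 else F (R / ‖x‖)
  have hin : ∀ x, ‖x‖ ≤ R → χ x = F 1 := by
    intro x hx
    by_cases h : x = 0
    · simp [χ, h]
    · simp only [χ, h, if_false]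
      exact hF1 _ ((one_le_div (norm_pos_iff.2 h)).2 hx)
  have hlocal0 : χ =ᶠ[nhds 0] fun _ => F 1 := by
    filter_upwards [Metric.closedBall_mem_nhds (0 : E3) hR] with x hx
    exact hin x (by simpa using hx)
  have hlocal : ∀ x, x ≠ 0 → χ =ᶠ[nhds x] fun y => F (R / ‖y‖) := by
    intro x hx
    filter_upwards [isOpen_ne.mem_nhds hx] with y hy
    simp only [χ, if_neg hy]
  have hfd : ∀ x, x ≠ 0 → HasFDerivAt χ
      (deriv F (R / ‖x‖) • (-(R / ‖x‖ ^ 2)) • fderiv ℝ (fun y : E3 => ‖y‖) x) x := by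
    intro x hx
    have hx' : ‖x‖ ≠ 0 := norm_ne_zero_iff.2 hx
    have h1 : HasFDerivAt (fun y : E3 => ‖y‖) (fderiv ℝ (fun y : E3 => ‖y‖) x) x :=
      ((contDiffAt_norm ℝ hx (n := 1)).differentiableAt (by simp)).hasFDerivAt
    have h2 : HasDerivAt (fun r : ℝ => R / r) (-(R / ‖x‖ ^ 2)) ‖x‖ := by
      have := (hasDerivAt_inv hx').const_mul R
      convert! this using 1
      ring
    have h3 : HasDerivAt F (deriv F (R / ‖x‖)) (R / ‖x‖) :=
      (hF.differentiable (by simp) _).hasDerivAt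
    exact (h3.comp_hasFDerivAt x (h2.comp_hasFDerivAt x h1)).congr_of_eventuallyEq (hlocal x hx)
  refine ⟨χ, F 1, ?_, ?_, hc, hin, ?_, ?_⟩
  · rw [contDiff_iff_contDiffAt]
    intro x
    by_cases hx : x = 0
    · subst hx
      exact contDiffAt_const.congr_of_eventuallyEq hlocal0
    · refine ContDiffAt.congr_of_eventuallyEq ?_ (hlocal x hx)
      exact hF.contDiffAt.comp x
        (contDiffAt_const.div (contDiffAt_norm ℝ hx) (norm_ne_zero_iff.2 hx))
  · refine HasCompactSupport.intro (isCompact_closedBall (0 : E3) (R / δ)) fun x hx => ?_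
    have hx : R / δ < ‖x‖ := by simpa using hx
    have hpos : 0 < ‖x‖ := (div_pos hR hδ).trans hx
    simp only [χ, if_neg (norm_pos_iff.1 hpos)]
    apply hF0
    rw [div_le_iff₀ hpos]
    rw [div_lt_iff₀ hδ] at hx
    linarith
  · intro x hx
    by_cases h : x = 0
    · subst h
      rw [hlocal0.fderiv_eq]
      simp
    · rw [(hfd x h).fderiv, hF'0 _ ((one_le_div (norm_pos_iff.2 h)).2 hx), zero_smul]
  · intro x hx
    have h : x ≠ 0 := norm_pos_iff.1 (hR.trans hx)
    rw [(hfd x h).fderiv, norm_smul, norm_smul,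
      norm_fderiv_norm ((contDiffAt_norm ℝ h (n := 1)).differentiableAt (by simp)), mul_one,
      norm_neg, Real.norm_of_nonneg (show 0 ≤ R / ‖x‖ ^ 2 by positivity)]
    exact mul_le_of_le_one_left (by positivity) (hF' _)

lemma continuous_gradient {f : E3 → ℝ} (hf : ContDiff ℝ 1 f) : Continuous (∇ f) :=
  (InnerProductSpace.toDual ℝ E3).symm.continuous.comp (hf.continuous_fderiv (by simp))

lemma integrable_fderiv_gradient {Φ χ : E3 → ℝ} (hΦ : ContDiff ℝ 1 Φ) (hχ : ContDiff ℝ 1 χ)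
    (hχc : HasCompactSupport χ) : Integrable (fun x => fderiv ℝ χ x (∇ Φ x)) := by
  apply Continuous.integrable_of_hasCompactSupport
  · exact (hχ.continuous_fderiv (by simp)).clm_apply (continuous_gradient hΦ)
  · refine (hχc.fderiv ℝ).mono fun x hx => ?_
    contrapose! hx
    simp_all

/-- Green's first identity against a compactly supported test function. -/
lemma integral_mul_lap3 {Φ χ : E3 → ℝ} (hΦ : ContDiff ℝ 2 Φ) (hχ : ContDiff ℝ 1 χ)
    (hχc : HasCompactSupport χ) :
    ∫ x, χ x * lap3 Φ x = -∫ x, fderiv ℝ χ x (∇ Φ x) := by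
  have hΦ' : ContDiff ℝ 1 (fderiv ℝ Φ) := hΦ.fderiv_right (by norm_num)
  have hD : ∀ i, ContDiff ℝ 1 fun x => fderiv ℝ Φ x (e3 i) := fun i =>
    hΦ'.clm_apply contDiff_const
  have hDc : ∀ i, Continuous fun x => fderiv ℝ (fun y => fderiv ℝ Φ y (e3 i)) x (e3 i) :=
    fun i => ((hD i).continuous_fderiv (by simp)).clm_apply continuous_const
  have hχ' : ∀ i, Continuous fun x => fderiv ℝ χ x (e3 i) := fun i =>
    (hχ.continuous_fderiv (by simp)).clm_apply continuous_const
  have hχc' : ∀ i, HasCompactSupport fun x => fderiv ℝ χ x (e3 i) := fun i =>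
    hχc.fderiv_apply ℝ (e3 i)
  have int1 : ∀ i, Integrable fun x =>
      χ x * fderiv ℝ (fun y => fderiv ℝ Φ y (e3 i)) x (e3 i) := fun i =>
    (hχ.continuous.mul (hDc i)).integrable_of_hasCompactSupport hχc.mul_right
  have int2 : ∀ i, Integrable fun x => fderiv ℝ χ x (e3 i) * fderiv ℝ Φ x (e3 i) := fun i =>
    ((hχ' i).mul (hD i).continuous).integrable_of_hasCompactSupport (hχc' i).mul_right
  have hlap : ∀ x, χ x * lap3 Φ x =
      ∑ i, χ x * fderiv ℝ (fun y => fderiv ℝ Φ y (e3 i)) x (e3 i) := by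
    intro x
    rw [lap3, Finset.mul_sum]
    refine Finset.sum_congr rfl fun i _ => ?_
    rw [iteratedFDeriv_two_apply,
      fderiv_clm_apply (hΦ'.differentiable (by simp) x) (differentiableAt_const _)]
    simp
  have hgrad : ∀ x, fderiv ℝ χ x (∇ Φ x) = ∑ i, fderiv ℝ χ x (e3 i) * fderiv ℝ Φ x (e3 i) := by
    intro x
    have hx : ∇ Φ x = ∑ i, fderiv ℝ Φ x (e3 i) • e3 i := by
      have := ((EuclideanSpace.basisFun (Fin 3) ℝ).sum_repr' (∇ Φ x)).symm
      rw [this]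
      refine Finset.sum_congr rfl fun i _ => ?_
      rw [real_inner_comm, inner_gradient_left]
      simp [e3]
    rw [hx, map_sum]
    refine Finset.sum_congr rfl fun i _ => ?_
    rw [map_smul, smul_eq_mul, mul_comm]
  simp_rw [hlap, hgrad]
  rw [integral_finsetSum _ fun i _ => int1 i, integral_finsetSum _ fun i _ => int2 i,
    ← Finset.sum_neg_distrib]
  refine Finset.sum_congr rfl fun i _ => ?_
  exact integral_mul_fderiv_eq_neg_fderiv_mul_of_integrable (int2 i) (int1 i)
    ((hχ.continuous.mul (hD i).continuous).integrable_of_hasCompactSupport hχc.mul_right)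
    (fun x _ => hχ.differentiable (by simp) x) fun x _ => (hD i).differentiable (by simp) x

/-- The Dirichlet energy of `R / ‖x‖` outside the ball of radius `R`. -/
lemma integrableOn_and_integral_compl_closedBall {R : ℝ} (hR : 0 < R) :
    IntegrableOn (fun x : E3 => (R / ‖x‖ ^ 2) ^ 2) (Metric.closedBall 0 R)ᶜ ∧
      ∫ x in (Metric.closedBall (0 : E3) R)ᶜ, (R / ‖x‖ ^ 2) ^ 2 = 4 * π * R := by
  let f : ℝ → ℝ := (Set.Ioi R).indicator fun r => (R / r ^ 2) ^ 2
  have hf : (Metric.closedBall (0 : E3) R)ᶜ.indicator (fun x => (R / ‖x‖ ^ 2) ^ 2) =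
      fun x => f ‖x‖ := by
    ext x
    simp [f, Set.indicator]
  have hdim : Module.finrank ℝ E3 - 1 = 2 := by simp
  have hrad : Set.EqOn (fun y : ℝ => y ^ (Module.finrank ℝ E3 - 1) • f y)
      ((Set.Ioi R).indicator fun r => R ^ 2 * r ^ (-2 : ℝ)) (Set.Ioi 0) := by
    intro y (hy : 0 < y)
    simp only [hdim, f, Set.indicator, smul_eq_mul]
    split_ifs
    · rw [rpow_neg hy.le, rpow_two]
      field_simp
    · simp
  have hms : MeasurableSet (Metric.closedBall (0 : E3) R)ᶜ := measurableSet_closedBall.compl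
  have hsub : Set.Ioi (0 : ℝ) ∩ Set.Ioi R = Set.Ioi R :=
    Set.inter_eq_right.2 (Set.Ioi_subset_Ioi hR.le)
  constructor
  · rw [← integrable_indicator_iff hms, hf, integrable_fun_norm_addHaar,
      integrableOn_congr_fun hrad measurableSet_Ioi, IntegrableOn,
      integrable_indicator_iff measurableSet_Ioi, IntegrableOn,
      Measure.restrict_restrict measurableSet_Ioi, Set.inter_comm, hsub]
    exact (integrableOn_Ioi_rpow_of_lt (by norm_num) hR).const_mul _
  · rw [← integral_indicator hms, hf, integral_fun_norm_addHaar,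
      setIntegral_congr_fun measurableSet_Ioi hrad, setIntegral_indicator measurableSet_Ioi, hsub,
      integral_const_mul, integral_Ioi_rpow_of_lt (by norm_num) hR, Measure.real,
      EuclideanSpace.volume_ball_fin_three]
    have h : R ^ (-2 + 1 : ℝ) = R⁻¹ := by norm_num [rpow_neg_one]
    rw [h]
    simp [ENNReal.toReal_ofReal (show 0 ≤ π * 4 / 3 by positivity)]
    field_simp
    ring

/-- Lower bound for the exterior field energy in terms of the enclosed charge. -/
lemma integral_compl_closedBall_gradient_sq_ge {R : ℝ} (hR : 0 < R) {ρ Φ : E3 → ℝ}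
    (hsupp : tsupport ρ ⊆ Metric.ball (0 : E3) R) (hΦ : ContDiff ℝ 2 Φ)
    (hpoisson : ∀ x, lap3 Φ x = -(4 * π) * ρ x) (hint : Integrable fun x => ‖∇ Φ x‖ ^ 2) :
    4 * π * (∫ x, ρ x) ^ 2 / R ≤ ∫ x in (Metric.closedBall (0 : E3) R)ᶜ, ‖∇ Φ x‖ ^ 2 := by
  set Q := ∫ x, ρ x with hQ
  set I := ∫ x in (Metric.closedBall (0 : E3) R)ᶜ, ‖∇ Φ x‖ ^ 2 with hI
  have hΦ1 : ContDiff ℝ 1 Φ := hΦ.of_le (by norm_num)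
  obtain ⟨hWint, hW⟩ := integrableOn_and_integral_compl_closedBall hR
  have key : ∀ δ, 0 < δ → δ < 1 / 8 → 4 * π * Q ^ 2 / R * (1 - 8 * δ) ≤ I := by
    intro δ hδ hδ'
    obtain ⟨χ, c, hχ, hχc, hc, hχin, hχ', hχ''⟩ := exists_radial_cutoff hR hδ hδ'
    have hflux : ∫ x in (Metric.closedBall (0 : E3) R)ᶜ, fderiv ℝ χ x (∇ Φ x) =
        4 * π * c * Q := by
      have h1 : ∫ x in (Metric.closedBall (0 : E3) R)ᶜ, fderiv ℝ χ x (∇ Φ x) =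
          ∫ x, fderiv ℝ χ x (∇ Φ x) := by
        apply setIntegral_eq_integral_of_forall_compl_eq_zero
        intro x hx
        rw [hχ' x (by simpa using hx)]
        simp
      have h2 : ∀ x, χ x * lap3 Φ x = -(4 * π * c) * ρ x := by
        intro x
        rw [hpoisson]
        by_cases hx : ‖x‖ ≤ R
        · rw [hχin x hx]
          ring
        · have hρ : ρ x = 0 := image_eq_zero_of_notMem_tsupport fun h =>
            hx (mem_ball_zero_iff.1 (hsupp h)).le
          simp [hρ]
      have h3 := integral_mul_lap3 hΦ hχ hχc
      simp_rw [h2] at h3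
      rw [integral_const_mul] at h3
      rw [h1]
      linarith
    have hineq : ∫ x in (Metric.closedBall (0 : E3) R)ᶜ,
        (2 * (Q / R) * fderiv ℝ χ x (∇ Φ x) - (Q / R) ^ 2 * (R / ‖x‖ ^ 2) ^ 2) ≤ I := by
      apply setIntegral_mono_on
      · exact (((integrable_fderiv_gradient hΦ1 hχ hχc).integrableOn).const_mul _).sub
          (hWint.const_mul _)
      · exact hint.integrableOn
      · exact measurableSet_closedBall.compl
      · intro x hx
        have hx : R < ‖x‖ := by simpa using hx
        have h1 : |fderiv ℝ χ x (∇ Φ x)| ≤ R / ‖x‖ ^ 2 * ‖∇ Φ x‖ :=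
          ((fderiv ℝ χ x).le_opNorm _).trans
            (mul_le_mul_of_nonneg_right (hχ'' x hx) (norm_nonneg _))
        have h2 : Q / R * fderiv ℝ χ x (∇ Φ x) ≤ |Q / R| * (R / ‖x‖ ^ 2 * ‖∇ Φ x‖) :=
          (le_abs_self _).trans ((abs_mul _ _).trans_le
            (mul_le_mul_of_nonneg_left h1 (abs_nonneg _)))
        have h3 := sq_nonneg (‖∇ Φ x‖ - |Q / R| * (R / ‖x‖ ^ 2))
        have h4 := sq_abs (Q / R)
        nlinarith
    rw [integral_sub (((integrable_fderiv_gradient hΦ1 hχ hχc).integrableOn).const_mul _)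
      (hWint.const_mul _), integral_const_mul, integral_const_mul, hflux, hW] at hineq
    refine le_trans ?_ hineq
    have h5 : 2 * (Q / R) * (4 * π * c * Q) - (Q / R) ^ 2 * (4 * π * R) =
        4 * π * Q ^ 2 / R * (2 * c - 1) := by
      field_simp
    rw [h5]
    exact mul_le_mul_of_nonneg_left (by linarith) (by positivity)
  have hlim : Tendsto (fun δ : ℝ => 4 * π * Q ^ 2 / R * (1 - 8 * δ)) (nhdsWithin 0 (Set.Ioi 0))
      (nhds (4 * π * Q ^ 2 / R)) := by
    refine tendsto_nhdsWithin_of_tendsto_nhds ?_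
    have : Continuous fun δ : ℝ => 4 * π * Q ^ 2 / R * (1 - 8 * δ) := by fun_prop
    simpa using this.tendsto 0
  refine le_of_tendsto hlim ?_
  filter_upwards [Ioo_mem_nhdsGT (show (0 : ℝ) < 1 / 8 by norm_num)] with δ hδ
  exact key δ hδ.1 hδ.2

/-- Refined electrostatic inequality: the energy excess over the shell configuration bounds
the field energy inside the enclosing ball:
`E − Q²/(2R) ≥ (1/(8π)) ∫_{B_R} |∇Φ|² dx`. -/
theorem electrostatic_interior_energy_bound (R : ℝ) (hR : 0 < R) (ρ : E3 → ℝ) (Φ : E3 → ℝ)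
    (hρc : Continuous ρ) (hρsupp : HasCompactSupport ρ)
    (hsupp : tsupport ρ ⊆ Metric.ball (0 : E3) R)
    (hΦ : ContDiff ℝ 2 Φ)
    (hpoisson : ∀ x, lap3 Φ x = -(4 * π) * ρ x)
    (hdecay : Tendsto Φ (cocompact E3) (nhds 0))
    (hint : Integrable (fun x => ‖∇ Φ x‖ ^ 2)) :
    (1 / (8 * π)) * ∫ x in Metric.closedBall (0 : E3) R, ‖∇ Φ x‖ ^ 2 ≤
      (1 / (8 * π)) * (∫ x, ‖∇ Φ x‖ ^ 2) - (∫ x, ρ x) ^ 2 / (2 * R) := by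
  have h := integral_compl_closedBall_gradient_sq_ge hR hsupp hΦ hpoisson hint
  rw [← integral_add_compl (measurableSet_closedBall (x := (0 : E3)) (ε := R)) hint]
  have hQ : (∫ x, ρ x) ^ 2 / (2 * R) = 1 / (8 * π) * (4 * π * (∫ x, ρ x) ^ 2 / R) := by
    field_simp
    ring
  rw [hQ, ← mul_sub]
  exact mul_le_mul_of_nonneg_left (by linarith) (by positivity)
end
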